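/- Let c ∈ ℝ and x > 0. Then (1/π) · ∫_{a=0}^{x} c·a^{1/2}·(x − a)^{−1/2} da = (c/2)·x. (Abel's example with n = 1/2 and time proportional to the square root of the height: the arclength is a linear function of the height, so the desired curve is a straight line.) -/

import Mathlib

/-- The real Beta integral over `[0, b]`, evaluated through the Gamma function. -/
theorem integral_rpow_mul_sub_rpow {s t b : ℝ} (hs : 0 < s) (ht : 0 < t) (hb : 0 < b) :
    ∫ a in (0 : ℝ)..b, a ^ (s - 1) * (b - a) ^ (t - 1)
      = b ^ (s + t - 1) * (Real.Gamma s * Real.Gamma t / Real.Gamma (s + t)) := by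
  have h := Complex.betaIntegral_scaled (s : ℂ) (t : ℂ) hb
  rw [Complex.betaIntegral_eq_Gamma_mul_div _ _ (by simpa using hs) (by simpa using ht)] at h
  apply Complex.ofReal_injective
  rw [← intervalIntegral.integral_ofReal]
  push_cast [Complex.ofReal_cpow hb.le, ← Complex.Gamma_ofReal]
  rw [← h]
  refine intervalIntegral.integral_congr fun a ha => ?_
  rw [Set.uIcc_of_le hb.le] at ha
  push_cast [Complex.ofReal_cpow ha.1, Complex.ofReal_cpow (sub_nonneg.2 ha.2)]
  rfl

/-- Abel's example with n = 1/2 and time proportional to the square root of the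
height: the arclength is a linear function of the height (a straight line). -/
theorem abel_straight_line_example
    (c x : ℝ) (hx : 0 < x) :
    (1 / Real.pi) * (∫ a in (0 : ℝ)..x, c * a ^ ((1 : ℝ) / 2) * (x - a) ^ (-(1 / 2) : ℝ))
      = (c / 2) * x := by
  have h := integral_rpow_mul_sub_rpow (s := 3 / 2) (t := 1 / 2) (by norm_num) (by norm_num) hx
  have hΓ : Real.Gamma (3 / 2) = 1 / 2 * √Real.pi := by
    rw [← Real.Gamma_one_half_eq, ← Real.Gamma_add_one (by norm_num)]
    norm_num
  norm_num [hΓ, Real.Gamma_two, Real.Gamma_one_half_eq, mul_assoc] at h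
  simp only [mul_assoc, intervalIntegral.integral_const_mul]
  norm_num
  rw [h]
  rw [Real.mul_self_sqrt Real.pi_pos.le]
  field_simp
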